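/- arXiv:1902.09373 — 3 statements merged into one kernel-verified Lean document; each statement's English description precedes it below -/
import Mathlib

section
/- For every 2 ≤ k ≤ n−1, setting g = t_n·t_{n−1}⋯t_{k+1} (i.e. g = ∏_{j=0}^{n−k−1} t_{n−j}, factors in decreasing order of the index), the following two conjugation identities hold in S_n: g·t_k·g^{−1} = t_{n−k+1}^{−1}·t_n and g·t_k^{−1}·g^{−1} = t_{n−1}^{n−k}·t_n^{k−1}. -/
/-!
Setup for the symmetric group `Sₙ`, realized as `Equiv.Perm (Fin n)` with `Fin n`
encoding `{1, …, n}` (0-indexed positions).  The paper multiplies permutations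
left-to-right: `(π·σ)(i) = σ(π(i))`, while Mathlib composes right-to-left:
`(π * σ) i = π (σ i)`.  Hence a paper product `a₁ · a₂ ⋯ a_k` is encoded as the
Mathlib product `a_k * ⋯ * a₂ * a₁` (the leftmost paper factor acts first).
-/

open Equiv Finset

/-- The adjacent transposition `sᵢ` (1-indexed values): the transposition `(i, i+1)`,
as a permutation of `Fin n`; junk value `1` outside the range `1 ≤ i ≤ n-1`. -/
def sP (n : ℕ) (i : ℕ) : Equiv.Perm (Fin n) :=
  if h : i < n then Equiv.swap ⟨i - 1, by omega⟩ ⟨i, h⟩ else 1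

/-- `tₘ = s₁·s₂⋯s_{m−1}` (left-to-right), i.e. the `m`-cycle sending `1 ↦ m` and
`j ↦ j−1` for `2 ≤ j ≤ m` (1-indexed), fixing every `j > m`; `t₁ = 1`. -/
def tP (n : ℕ) (m : ℕ) : Equiv.Perm (Fin n) :=
  if h : m - 1 < n then ((⟨m - 1, h⟩ : Fin n).cycleRange)⁻¹ else 1

/-- The paper's left-to-right product `f a · f (a+1) ⋯ f b` (increasing indices,
so `f a` acts first), encoded in Mathlib's composition order. -/
def ogsProd {n : ℕ} (a b : ℕ) (f : ℕ → Equiv.Perm (Fin n)) : Equiv.Perm (Fin n) :=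
  ((List.range' a (b + 1 - a)).map f).reverse.prod

/-- The paper's left-to-right product `f b · f (b−1) ⋯ f a` (decreasing indices,
so `f b` acts first), encoded in Mathlib's composition order. -/
def ogsProdDesc {n : ℕ} (a b : ℕ) (f : ℕ → Equiv.Perm (Fin n)) : Equiv.Perm (Fin n) :=
  ((List.range' a (b + 1 - a)).map f).prod

/-- The Coxeter length of `π`: the number of inversions, i.e. of pairs `i < j`
with `π(i) > π(j)`. -/
def len {n : ℕ} (π : Equiv.Perm (Fin n)) : ℕ :=
  (Finset.univ.filter fun p : Fin n × Fin n => p.1 < p.2 ∧ π p.2 < π p.1).card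

/-- The descent set of `π`: the set of 1-indexed positions `i ∈ {1, …, n−1}`
with `π(i) > π(i+1)`. -/
def descents {n : ℕ} (π : Equiv.Perm (Fin n)) : Finset ℕ :=
  (Finset.Ico 1 n).filter fun i => ∃ h : i < n, π ⟨i, h⟩ < π ⟨i - 1, by omega⟩

theorem tP_apply_val {n m : ℕ} (hm : 1 ≤ m) (hmn : m ≤ n) (x : Fin n) :
    (tP n m x : ℕ) = if (x : ℕ) < m then (if (x : ℕ) = 0 then m - 1 else (x : ℕ) - 1) else x := by
  have h : m - 1 < n := by omega
  obtain ⟨y, rfl⟩ := ((⟨m - 1, h⟩ : Fin n).cycleRange).surjective x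
  have hy : tP n m ((⟨m - 1, h⟩ : Fin n).cycleRange y) = y := by simp [tP, h]
  rw [hy]
  rcases lt_trichotomy y ⟨m - 1, h⟩ with hlt | heq | hgt
  · rw [Fin.coe_cycleRange_of_lt hlt]
    have hlt' : (y : ℕ) < m - 1 := hlt
    rw [if_pos (by omega), if_neg (by omega), Nat.add_sub_cancel]
  · have : NeZero n := ⟨by omega⟩
    rw [heq, Fin.cycleRange_self]
    simp only [Fin.val_zero]
    split_ifs <;> omega
  · rw [Fin.cycleRange_of_gt hgt]
    have hgt' : m - 1 < (y : ℕ) := hgt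
    split_ifs <;> omega

theorem tP_pow_apply_val {n m : ℕ} (hm : 1 ≤ m) (hmn : m ≤ n) (x : Fin n) {a : ℕ} (ha : a ≤ m) :
    ((tP n m ^ a) x : ℕ) =
      if (x : ℕ) < m then (if a ≤ (x : ℕ) then x - a else x + m - a) else x := by
  induction a with
  | zero => simp
  | succ a ih =>
    rw [pow_succ', Equiv.Perm.mul_apply, tP_apply_val hm hmn, ih (by omega)]
    split_ifs <;> omega

theorem ogsProdDesc_self_succ {n : ℕ} (b : ℕ) (f : ℕ → Equiv.Perm (Fin n)) :
    ogsProdDesc (b + 1) b f = 1 := by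
  simp [ogsProdDesc]

theorem ogsProdDesc_eq_mul {n a b : ℕ} (hab : a ≤ b) (f : ℕ → Equiv.Perm (Fin n)) :
    ogsProdDesc a b f = f a * ogsProdDesc (a + 1) b f := by
  have h : b + 1 - a = (b + 1 - (a + 1)) + 1 := by omega
  simp [ogsProdDesc, h, List.range'_succ]

theorem ogsProdDesc_tP_apply_val {n : ℕ} (d k : ℕ) (hn : d + k = n) (x : Fin n) :
    (ogsProdDesc (k + 1) n (tP n) x : ℕ) = if (x : ℕ) < d then n - 1 - x else (x : ℕ) - d := by
  induction d generalizing k with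
  | zero =>
    obtain rfl : k = n := by omega
    simp [ogsProdDesc_self_succ]
  | succ d ih =>
    rw [ogsProdDesc_eq_mul (by omega), Equiv.Perm.mul_apply,
      tP_apply_val (by omega) (by omega), ih (k + 1) (by omega)]
    have := x.isLt
    split_ifs <;> omega

/-- For `2 ≤ k ≤ n−1`, with `g = tₙ·t_{n−1}⋯t_{k+1}` (left-to-right,
decreasing indices), one has `g·t_k·g⁻¹ = t_{n−k+1}⁻¹·tₙ` and
`g·t_k⁻¹·g⁻¹ = t_{n−1}^{n−k}·tₙ^{k−1}` (paper products `a·b·c` encoded as `c * b * a`). -/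
theorem conjugation_identities (n k : ℕ) (hk : 2 ≤ k) (hkn : k ≤ n - 1)
    (g : Equiv.Perm (Fin n)) (hg : g = ogsProdDesc (k + 1) n (tP n)) :
    g⁻¹ * tP n k * g = tP n n * (tP n (n - k + 1))⁻¹ ∧
    g⁻¹ * (tP n k)⁻¹ * g = tP n n ^ (k - 1) * tP n (n - 1) ^ (n - k) := by
  subst hg
  constructor
  · rw [eq_mul_inv_iff_mul_eq, mul_assoc, mul_assoc, inv_mul_eq_iff_eq_mul]
    ext x
    have := x.isLt
    simp only [Equiv.Perm.mul_apply]
    rw [tP_apply_val (by omega) (by omega), ogsProdDesc_tP_apply_val (n - k) k (by omega),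
      ogsProdDesc_tP_apply_val (n - k) k (by omega), tP_apply_val (by omega) (by omega),
      tP_apply_val (by omega) (by omega)]
    split_ifs <;> omega
  · rw [mul_assoc, inv_mul_eq_iff_eq_mul, inv_mul_eq_iff_eq_mul]
    ext x
    have := x.isLt
    simp only [Equiv.Perm.mul_apply]
    have hy := tP_pow_apply_val (m := n - 1) (by omega) (by omega) x (a := n - k) (by omega)
    generalize (tP n (n - 1) ^ (n - k)) x = y at hy ⊢
    have hz := tP_pow_apply_val (m := n) (by omega) le_rfl y (a := k - 1) (by omega)
    generalize (tP n n ^ (k - 1)) y = z at hz ⊢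
    rw [tP_apply_val (by omega) (by omega), ogsProdDesc_tP_apply_val (n - k) k (by omega),
      ogsProdDesc_tP_apply_val (n - k) k (by omega)]
    have := y.isLt
    rw [if_pos this] at hz
    rcases lt_or_ge (x : ℕ) (n - 1) with h | h
    · rw [if_pos h] at hy
      split_ifs at hy hz ⊢ <;> omega
    · rw [if_neg (by omega)] at hy
      split_ifs at hz ⊢ <;> omega
end

section
/- For every 2 ≤ k ≤ n and every 1 ≤ i ≤ k−1, one has in S_n: t_k^i = ∏_{u=i}^{k−1} (s_u·s_{u−1}⋯s_{u−i+1}), where the outer product is taken in increasing order of u and each inner factor is the decreasing run of i adjacent transpositions starting at s_u. -/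
/-!
Setup for the symmetric group `Sₙ`, realized as `Equiv.Perm (Fin n)` with `Fin n`
encoding `{1, …, n}` (0-indexed positions).  The paper multiplies permutations
left-to-right: `(π·σ)(i) = σ(π(i))`, while Mathlib composes right-to-left:
`(π * σ) i = π (σ i)`.  Hence a paper product `a₁ · a₂ ⋯ a_k` is encoded as the
Mathlib product `a_k * ⋯ * a₂ * a₁` (the leftmost paper factor acts first).
-/

open Equiv Finset

/-- `sP n (b + 1)` swaps the 0-indexed values `b` and `b + 1`. -/
theorem val_sP_succ_apply {n b : ℕ} (hb : b + 1 < n) (x : Fin n) :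
    (sP n (b + 1) x : ℕ) =
      if (x : ℕ) = b then b + 1 else if (x : ℕ) = b + 1 then b else x := by
  simp only [sP, hb, dif_pos, Equiv.swap_apply_def, Fin.ext_iff]
  split_ifs <;> simp_all

/-- A run of `L` adjacent transpositions is the cycle moving `b + L` to `b` and shifting
`b, …, b + L - 1` up by one. -/
theorem val_prod_range'_sP_apply {n b L : ℕ} (h : b + L < n) (x : Fin n) :
    ((((List.range' (b + 1) L).map (sP n)).prod x : Fin n) : ℕ) =
      if (x : ℕ) = b + L then b else if b ≤ x ∧ (x : ℕ) < b + L then x + 1 else x := by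
  induction L generalizing x with
  | zero => simp; split_ifs <;> omega
  | succ L ih =>
    rw [List.range'_concat, List.map_append, List.prod_append, Equiv.Perm.mul_apply,
      ih (by omega)]
    have hs := val_sP_succ_apply (b := b + L) (by omega) x
    simp only [List.map_cons, List.map_nil, List.prod_singleton, one_mul,
      show b + 1 + L = b + L + 1 by omega]
    split_ifs at hs ⊢ <;> omega

theorem val_ogsProdDesc_sP_apply {n i u : ℕ} (hi : 1 ≤ i) (hiu : i ≤ u) (hu : u < n)
    (x : Fin n) :
    (ogsProdDesc (u - i + 1) u (sP n) x : ℕ) =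
      if (x : ℕ) = u then u - i else if u - i ≤ x ∧ (x : ℕ) < u then x + 1 else x := by
  have h := val_prod_range'_sP_apply (n := n) (b := u - i) (L := i) (by omega) x
  rw [ogsProdDesc, show u + 1 - (u - i + 1) = i by omega, h, show u - i + i = u by omega]

/-- The product of the first `L` runs of length `i` rotates `0, …, i + L - 1` down by `i`. -/
theorem val_prod_reverse_runs_apply {n i L : ℕ} (hi : 1 ≤ i) (h : i + L ≤ n) (x : Fin n) :
    ((((List.range' i L).map
      (fun u => ogsProdDesc (u - i + 1) u (sP n))).reverse.prod x : Fin n) : ℕ) =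
      if (x : ℕ) < i then x + L else if (x : ℕ) < i + L then x - i else x := by
  induction L with
  | zero => simp; omega
  | succ L ih =>
    specialize ih (by omega)
    rw [List.range'_concat, List.map_append, List.reverse_append, List.prod_append,
      Equiv.Perm.mul_apply]
    simp only [List.map_cons, List.map_nil, List.reverse_singleton, List.prod_singleton, one_mul]
    rw [val_ogsProdDesc_sP_apply hi (by omega) (by omega), ih]
    split_ifs <;> omega

theorem val_tP_apply {n k : ℕ} (hk : 1 ≤ k) (hkn : k ≤ n) (x : Fin n) :
    (tP n k x : ℕ) = if (x : ℕ) = 0 then k - 1 else if (x : ℕ) < k then x - 1 else x := by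
  have h : k - 1 < n := by omega
  rw [tP, dif_pos h]
  have : NeZero n := ⟨by omega⟩
  obtain ⟨y, rfl⟩ := (Fin.cycleRange ⟨k - 1, h⟩).surjective x
  rw [← Equiv.Perm.mul_apply, inv_mul_cancel, Equiv.Perm.one_apply]
  rcases lt_trichotomy y ⟨k - 1, h⟩ with hy | hy | hy
  · rw [Fin.coe_cycleRange_of_lt hy]
    rw [Fin.lt_def] at hy
    dsimp only at hy
    rw [if_neg (by omega), if_pos (by omega), Nat.add_sub_cancel]
  · rw [Fin.cycleRange_of_eq hy]
    simp [hy]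
  · rw [Fin.cycleRange_of_gt hy]
    rw [Fin.lt_def] at hy
    dsimp only at hy
    split_ifs <;> omega

theorem val_tP_pow_apply {n k i : ℕ} (hk : 1 ≤ k) (hkn : k ≤ n) (hik : i ≤ k) (x : Fin n) :
    ((tP n k ^ i) x : ℕ) =
      if (x : ℕ) < i then x + (k - i) else if (x : ℕ) < k then x - i else x := by
  induction i with
  | zero => simp
  | succ i ih =>
    rw [pow_succ', Equiv.Perm.mul_apply, val_tP_apply hk hkn, ih (by omega)]
    split_ifs <;> omega

/-- For `2 ≤ k ≤ n` and `1 ≤ i ≤ k−1`: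
`t_k^i = ∏_{u=i}^{k−1} (s_u·s_{u−1}⋯s_{u−i+1})`, the outer product taken
left-to-right in increasing order of `u`, each inner factor being the decreasing
run of `i` adjacent transpositions starting at `s_u`. -/
theorem t_pow_normal_form (n k i : ℕ) (hk : 2 ≤ k) (hkn : k ≤ n)
    (hi : 1 ≤ i) (hik : i ≤ k - 1) :
    tP n k ^ i = ogsProd i (k - 1) (fun u => ogsProdDesc (u - i + 1) u (sP n)) := by
  ext x
  rw [val_tP_pow_apply (by omega) hkn (by omega), ogsProd,
    val_prod_reverse_runs_apply hi (by omega), show k - 1 + 1 - i = k - i by omega,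
    show i + (k - i) = k by omega]
end

section
/- Let π₁ = ∏_{j=1}^{m} t_{k_j}^{i_{k_j}} and π₂ = ∏_{j=1}^{w} t_{r_j}^{i_{r_j}} be elements of S_n presented in standard OGS canonical form (2 ≤ k_1 < ⋯ < k_m ≤ n with 0 < i_{k_j} < k_j, and 2 ≤ r_1 < ⋯ < r_w ≤ n with 0 < i_{r_j} < r_j). If Σ_{j=1}^{w} i_{r_j} = r_1 and i_{r_1} ≥ k_m, then π₁ and π₂ commute: π₁·π₂ = π₂·π₁. -/
/-!
Setup for the symmetric group `Sₙ`, realized as `Equiv.Perm (Fin n)` with `Fin n`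
encoding `{1, …, n}` (0-indexed positions).  The paper multiplies permutations
left-to-right: `(π·σ)(i) = σ(π(i))`, while Mathlib composes right-to-left:
`(π * σ) i = π (σ i)`.  Hence a paper product `a₁ · a₂ ⋯ a_k` is encoded as the
Mathlib product `a_k * ⋯ * a₂ * a₁` (the leftmost paper factor acts first).
-/

open Equiv Finset

/-- `ogsProd 1 (b + 1) f` is `ogsProd 1 b f` followed by `f (b + 1)`. -/
theorem ogsProd_one_succ {n : ℕ} (b : ℕ) (f : ℕ → Equiv.Perm (Fin n)) :
    ogsProd 1 (b + 1) f = f (b + 1) * ogsProd 1 b f := by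
  simp [ogsProd, List.range'_concat, add_comm]

theorem ogsProd_one_zero {n : ℕ} (f : ℕ → Equiv.Perm (Fin n)) : ogsProd 1 0 f = 1 := by
  simp [ogsProd]

/-- `tP n p` moves every nonzero position below `p` down by one. -/
theorem tP_apply_of_pos {n p : ℕ} (hp : p ≤ n) {x y : Fin n} (hx : (x : ℕ) < p)
    (hy : (y : ℕ) + 1 = x) : tP n p x = y := by
  rw [tP, dif_pos (by omega), Equiv.Perm.inv_eq_iff_eq]
  ext
  rw [Fin.coe_cycleRange_of_lt (Fin.lt_def.2 (by dsimp only; omega)), hy]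

/-- `tP n p` sends the first position to the `p`-th one. -/
theorem tP_apply_zero {n p : ℕ} (hp : p ≤ n) {x y : Fin n} (hx : (x : ℕ) = 0)
    (hy : (y : ℕ) + 1 = p) : tP n p x = y := by
  rw [tP, dif_pos (by omega), Equiv.Perm.inv_eq_iff_eq]
  have : NeZero n := ⟨by omega⟩
  rw [Fin.cycleRange_of_eq (Fin.ext (by dsimp only; omega))]
  exact Fin.ext (by simpa using hx)

theorem tP_apply_of_le {n p : ℕ} (hp : 1 ≤ p) {x : Fin n} (hx : p ≤ x) : tP n p x = x := by
  rw [tP, dif_pos (by omega), Equiv.Perm.inv_eq_iff_eq,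
    Fin.cycleRange_of_gt (Fin.lt_def.2 (by dsimp only; omega))]

theorem tP_pow_apply_of_le {n p : ℕ} (hp : p ≤ n) (e : ℕ) {x y : Fin n} (hx : (x : ℕ) < p)
    (hy : (y : ℕ) + e = x) : (tP n p ^ e) x = y := by
  induction e generalizing y with
  | zero => exact Fin.ext (by simpa using hy.symm)
  | succ e ih =>
    rw [pow_succ', Equiv.Perm.mul_apply, ih (y := ⟨y + 1, by omega⟩) (by dsimp only; omega)]
    exact tP_apply_of_pos hp (by dsimp only; omega) rfl

theorem tP_pow_apply_of_lt {n p : ℕ} (hp : p ≤ n) {e : ℕ} (he : e ≤ p) {x y : Fin n}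
    (hx : (x : ℕ) < e) (hy : (y : ℕ) + e = x + p) : (tP n p ^ e) x = y := by
  have hsplit : e = (e - x - 1) + (1 + x) := by omega
  rw [hsplit, pow_add, pow_add, pow_one, Equiv.Perm.mul_apply, Equiv.Perm.mul_apply,
    tP_pow_apply_of_le hp x (y := ⟨0, by omega⟩) (by omega) (by simp),
    tP_apply_zero hp (y := ⟨p - 1, by omega⟩) rfl (by dsimp only; omega)]
  exact tP_pow_apply_of_le hp _ (by dsimp only; omega) (by dsimp only; omega)

/-- A product of powers of `tP n (k j)` with all `k j ≤ K` fixes every position from `K` on. -/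
theorem ogsProd_tP_pow_apply_of_le {n K m : ℕ} {k i : ℕ → ℕ}
    (hk : ∀ j, 1 ≤ j → j ≤ m → 1 ≤ k j ∧ k j ≤ K) {x : Fin n} (hx : K ≤ x) :
    (ogsProd 1 m fun j => tP n (k j) ^ i j) x = x := by
  induction m with
  | zero => simp [ogsProd_one_zero]
  | succ m ih =>
    rw [ogsProd_one_succ, Equiv.Perm.mul_apply, ih fun j h₁ h₂ => hk j h₁ (by omega)]
    obtain ⟨h₁, h₂⟩ := hk (m + 1) (by omega) le_rfl
    exact Equiv.Perm.pow_apply_eq_self_of_apply_eq_self (tP_apply_of_le h₁ (by omega)) _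

/-- If the exponents sum to at most `r 1`, the positions below the first exponent are raised by
`r 1` and lowered by the sum of the exponents. -/
theorem ogsProd_tP_pow_apply_of_lt {n w : ℕ} {r e : ℕ → ℕ} (hw : 1 ≤ w)
    (hr : ∀ j, 1 ≤ j → j ≤ w → r 1 ≤ r j ∧ r j ≤ n)
    (hsum : ∑ j ∈ Finset.Icc 1 w, e j ≤ r 1) {x y : Fin n} (hx : (x : ℕ) < e 1)
    (hy : (y : ℕ) + ∑ j ∈ Finset.Icc 1 w, e j = x + r 1) :
    (ogsProd 1 w fun j => tP n (r j) ^ e j) x = y := by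
  induction w, hw using Nat.le_induction generalizing y with
  | base =>
    rw [Finset.Icc_self, Finset.sum_singleton] at hsum hy
    rw [ogsProd_one_succ, ogsProd_one_zero, mul_one]
    exact tP_pow_apply_of_lt (hr 1 le_rfl le_rfl).2 hsum hx hy
  | succ w hw ih =>
    rw [Finset.sum_Icc_succ_top (by omega)] at hsum hy
    have hfirst : e 1 ≤ ∑ j ∈ Finset.Icc 1 w, e j :=
      Finset.single_le_sum (f := e) (fun _ _ => Nat.zero_le _) (Finset.mem_Icc.2 ⟨le_rfl, hw⟩)
    obtain ⟨h₁, h₂⟩ := hr (w + 1) (by omega) le_rfl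
    rw [ogsProd_one_succ, Equiv.Perm.mul_apply,
      ih (fun j h h' => hr j h (by omega)) (by omega) (y := ⟨y + e (w + 1), by omega⟩)
        (by dsimp only; omega)]
    exact tP_pow_apply_of_le h₂ _ (by dsimp only; omega) rfl

/-- If `π₁ = ∏_{j=1}^{m} t_{k_j}^{i_j}` and
`π₂ = ∏_{j=1}^{w} t_{r_j}^{i'_j}` are in standard OGS canonical form with
`Σ_{j=1}^{w} i'_j = r₁` and `i'_1 ≥ k_m`, then `π₁` and `π₂` commute. -/
theorem commuting_criterion (n m w : ℕ) (k i r i' : ℕ → ℕ) (hm : 1 ≤ m) (hw : 1 ≤ w)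
    (hk : ∀ j, 1 ≤ j → j ≤ m → 2 ≤ k j ∧ k j ≤ n)
    (hkmono : ∀ j, 1 ≤ j → j < m → k j < k (j + 1))
    (hi : ∀ j, 1 ≤ j → j ≤ m → 0 < i j ∧ i j < k j)
    (hr : ∀ j, 1 ≤ j → j ≤ w → 2 ≤ r j ∧ r j ≤ n)
    (hrmono : ∀ j, 1 ≤ j → j < w → r j < r (j + 1))
    (hi' : ∀ j, 1 ≤ j → j ≤ w → 0 < i' j ∧ i' j < r j)
    (hmaj : ∑ j ∈ Finset.Icc 1 w, i' j = r 1)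
    (hbig : k m ≤ i' 1)
    (π₁ π₂ : Equiv.Perm (Fin n))
    (hπ₁ : π₁ = ogsProd 1 m fun j => tP n (k j) ^ i j)
    (hπ₂ : π₂ = ogsProd 1 w fun j => tP n (r j) ^ i' j) :
    π₁ * π₂ = π₂ * π₁ := by
  have hkle : ∀ j, 1 ≤ j → j ≤ m → k j ≤ k m := fun j h₁ h₂ =>
    Nat.le_induction (m := j) (P := fun l _ => l ≤ m → k j ≤ k l) (fun _ => le_rfl)
      (fun l hl ih hlm => (ih (by omega)).trans (hkmono l (by omega) (by omega)).le) m h₂ le_rfl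
  have hrle : ∀ j, 1 ≤ j → j ≤ w → r 1 ≤ r j := fun j h₁ =>
    Nat.le_induction (m := 1) (P := fun l _ => l ≤ w → r 1 ≤ r l) (fun _ => le_rfl)
      (fun l hl ih hlw => (ih (by omega)).trans (hrmono l (by omega) (by omega)).le) j h₁
  subst hπ₁ hπ₂
  refine Equiv.Perm.Disjoint.commute fun x => ?_
  rcases le_or_gt (k m) x with hx | hx
  · exact .inl (ogsProd_tP_pow_apply_of_le
      (fun j h₁ h₂ => ⟨by linarith [(hk j h₁ h₂).1], hkle j h₁ h₂⟩) hx)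
  · exact .inr (ogsProd_tP_pow_apply_of_lt hw
      (fun j h₁ h₂ => ⟨hrle j h₁ h₂, (hr j h₁ h₂).2⟩) hmaj.le (by omega) (by rw [hmaj]))
end
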